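/- arXiv:1703.06540 — 2 statements merged into one kernel-verified Lean document; each statement's English description precedes it below -/
import Mathlib

section
/- In the Cayley graph of S₅ with connection set the transpositions {(1 3), (2 3), (3 4), (4 5)} (the Cayley graph X³_{3,2} of the double-star tree with centers of degrees 3 and 2), there exists a 1-sphere packing consisting of 20 permutations, whose closed neighborhoods (each of size 5) are pairwise disjoint and cover 100 of the 120 vertices. -/
/-- The closed neighborhood `N[v]` of a vertex (the 1-sphere centered at `v`). -/
def closedNbr {V : Type*} (G : SimpleGraph V) (v : V) : Set V :=
  insert v (G.neighborSet v)

/-- A 1-sphere packing: a set of vertices with pairwise disjoint closed neighborhoods. -/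
def IsSpherePacking {V : Type*} (G : SimpleGraph V) (J : Set V) : Prop :=
  J.Pairwise fun u v => Disjoint (closedNbr G u) (closedNbr G v)

/-- An efficient dominating set: an independent set such that every vertex outside it
is adjacent to exactly one of its members. -/
def IsEDS {V : Type*} (G : SimpleGraph V) (J : Set V) : Prop :=
  (∀ u ∈ J, ∀ v ∈ J, ¬ G.Adj u v) ∧ ∀ v, v ∉ J → ∃! u, u ∈ J ∧ G.Adj v u

/-- An efficient dominating set of the subgraph of `G` induced on the set `S`. -/
def IsEDSOn {V : Type*} (G : SimpleGraph V) (S J : Set V) : Prop :=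
  J ⊆ S ∧ (∀ u ∈ J, ∀ v ∈ J, ¬ G.Adj u v) ∧
    ∀ v ∈ S, v ∉ J → ∃! u, u ∈ J ∧ G.Adj v u

/-- The Cayley graph `X(Sₙ, τ)` of the symmetric group on `Fin n` with connection set
the transpositions coming from the edges of the graph `τ`. -/
def cayley {n : ℕ} (τ : SimpleGraph (Fin n)) : SimpleGraph (Equiv.Perm (Fin n)) :=
  SimpleGraph.fromRel fun g h => ∃ i j : Fin n, τ.Adj i j ∧ h * g⁻¹ = Equiv.swap i j

/-- The double-star tree `τ³_{r,t}` on `{1,…,r+t}` (0-indexed on `Fin (r+t)`): edges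
`{i, r}` for `1 ≤ i ≤ r-1`, the central edge `{r, r+1}`, and `{r+1, j}` for `r+2 ≤ j ≤ n`
(1-indexed), i.e. 0-indexed: `{i, r-1}` for `i < r-1`, `{r-1, r}`, and `{r, j}` for `r < j`. -/
def doubleStar (r t : ℕ) : SimpleGraph (Fin (r + t)) :=
  SimpleGraph.fromRel fun i j =>
    ((i : ℕ) < r - 1 ∧ (j : ℕ) = r - 1) ∨ ((i : ℕ) = r - 1 ∧ (j : ℕ) = r) ∨
      ((i : ℕ) = r ∧ r < (j : ℕ))

/-- `X³_{r,t}`, the Cayley graph of the double-star tree. -/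
def X3 (r t : ℕ) : SimpleGraph (Equiv.Perm (Fin (r + t))) :=
  cayley (doubleStar r t)

/-- The star Cayley graph on `S_m` with center `m` (0-indexed: center `m-1`):
connection set the transpositions `(i, m-1)` with `i < m-1`. -/
def starGraph (m : ℕ) : SimpleGraph (Equiv.Perm (Fin m)) :=
  SimpleGraph.fromRel fun g h =>
    ∃ i j : Fin m, (i : ℕ) < m - 1 ∧ (j : ℕ) = m - 1 ∧ h * g⁻¹ = Equiv.swap i j

/-- A star-like Cayley graph on `Equiv.Perm (Fin n)` with center `c` and leaf set `S`:
connection set the transpositions `(i, c)` with `i ∈ S`. -/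
def starAt {n : ℕ} (c : Fin n) (S : Set (Fin n)) : SimpleGraph (Equiv.Perm (Fin n)) :=
  SimpleGraph.fromRel fun g h => ∃ i ∈ S, h * g⁻¹ = Equiv.swap i c

/-- The Johnson graph `Γ^r_n`: vertices the `r`-subsets of `{1,…,n}`, adjacency
meaning intersection of size `r-1`. -/
def johnson (n r : ℕ) : SimpleGraph {A : Finset (Fin n) // A.card = r} :=
  SimpleGraph.fromRel fun A B => (A.val ∩ B.val).card = r - 1

/-- A subgraph `Ψ` of `Γ^r_n` is exact if (a) any two of its edges incident to a common
vertex have colors sharing exactly `r-2` elements, and (b) the vertices of any path of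
length 2 in `Ψ` involve exactly `r+2` elements. -/
def IsExact {n r : ℕ} (Ψ : SimpleGraph {A : Finset (Fin n) // A.card = r}) : Prop :=
  (∀ u v w, Ψ.Adj u v → Ψ.Adj u w → v ≠ w →
    ((u.val ∩ v.val) ∩ (u.val ∩ w.val)).card = r - 2) ∧
  (∀ u v w, Ψ.Adj u v → Ψ.Adj v w → u ≠ w →
    (u.val ∪ v.val ∪ w.val).card = r + 2)

/-- A unicyclic caterpillar: a connected graph with exactly one cycle (for a finite
connected graph, `#edges = #vertices`) such that deleting its vertices of degree 1
leaves precisely that cycle (the subgraph induced on the vertices of degree at least 2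
is a (connected, 2-regular) cycle). -/
def IsUnicyclicCaterpillar {V : Type*} (H : SimpleGraph V) : Prop :=
  H.Connected ∧ H.edgeSet.ncard = Nat.card V ∧
  (H.induce {v | 2 ≤ (H.neighborSet v).ncard}).Connected ∧
  ∀ v, ((H.induce {v | 2 ≤ (H.neighborSet v).ncard}).neighborSet v).ncard = 2

/-- A nest of `Γ^r_n`: an exact spanning subgraph of maximum degree at most 3 each of
whose connected components is a unicyclic caterpillar. -/
def HasNest (n r : ℕ) : Prop :=
  ∃ Ψ : SimpleGraph {A : Finset (Fin n) // A.card = r},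
    Ψ ≤ johnson n r ∧ IsExact Ψ ∧ (∀ v, (Ψ.neighborSet v).ncard ≤ 3) ∧
    ∀ c : Ψ.ConnectedComponent, IsUnicyclicCaterpillar (Ψ.induce c.supp)

/-- `P_r` from Theorem 7 of the paper. -/
def Pnum (r : ℕ) : ℕ :=
  if r % 2 = 1 then Nat.choose (2 * r) r - 2 ^ r
  else Nat.choose (2 * r) r - 2 ^ r - Nat.choose r (r / 2)

/-- The Young subgroup `H = S_{{1,…,r}} × S_{{r+1,…,n}}` as a subset of `S_{r+t}`. -/
def youngH (r t : ℕ) : Set (Equiv.Perm (Fin (r + t))) :=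
  {σ | (⇑σ) '' {i : Fin (r + t) | (i : ℕ) < r} = {i : Fin (r + t) | (i : ℕ) < r}}

/-- The edges from a cyclically ordered vertex list. -/
def cycleEdges {α : Type*} (l : List α) : List (α × α) := l.zip (l.rotate 1)


namespace FrobeniusPacking

open Equiv

/-- The identity together with the four transpositions `(0 2)`, `(1 2)`, `(2 3)`, `(3 4)`. -/
def sphereAtOne : Finset (Perm (Fin 5)) :=
  {1, swap 0 2, swap 1 2, swap 2 3, swap 3 4}

/-- The 5-cycle `0 → 1 → 4 → 2 → 3 → 0`. -/
def fiveCycle : Perm (Fin 5) :=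
  swap 0 1 * swap 1 4 * swap 4 2 * swap 2 3

/-- The normalizer of the subgroup generated by `fiveCycle`, a Frobenius group of order 20. -/
def frobeniusTwenty : Finset (Perm (Fin 5)) :=
  {g | ∃ k : Fin 5, g * fiveCycle = fiveCycle ^ (k : ℕ) * g}

theorem card_frobeniusTwenty : frobeniusTwenty.card = 20 := by
  decide +kernel

theorem mul_inv_mem_frobeniusTwenty :
    ∀ u ∈ frobeniusTwenty, ∀ v ∈ frobeniusTwenty, v * u⁻¹ ∈ frobeniusTwenty := by
  decide +kernel

theorem eq_of_inv_mul_mem_frobeniusTwenty :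
    ∀ a ∈ sphereAtOne, ∀ b ∈ sphereAtOne, b⁻¹ * a ∈ frobeniusTwenty → a = b := by
  decide +kernel

theorem disjoint_image_sphereAtOne {u v : Perm (Fin 5)} (hu : u ∈ frobeniusTwenty)
    (hv : v ∈ frobeniusTwenty) (huv : u ≠ v) :
    Disjoint (sphereAtOne.image (· * u)) (sphereAtOne.image (· * v)) := by
  rw [Finset.disjoint_left]
  intro x hxu hxv
  obtain ⟨a, ha, rfl⟩ := Finset.mem_image.mp hxu
  obtain ⟨b, hb, hab⟩ := Finset.mem_image.mp hxv
  have h : b⁻¹ * a = v * u⁻¹ := by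
    rw [inv_mul_eq_iff_eq_mul, ← mul_assoc, eq_mul_inv_iff_mul_eq]
    exact hab.symm
  obtain rfl := eq_of_inv_mul_mem_frobeniusTwenty a ha b hb
    (h ▸ mul_inv_mem_frobeniusTwenty u hu v hv)
  exact huv (mul_left_cancel hab).symm

theorem closedNbr_fromRel_eq_image (v : Perm (Fin 5)) :
    closedNbr (SimpleGraph.fromRel fun g h : Perm (Fin 5) =>
      h * g⁻¹ = swap 0 2 ∨ h * g⁻¹ = swap 1 2 ∨ h * g⁻¹ = swap 2 3 ∨ h * g⁻¹ = swap 3 4) v =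
      (sphereAtOne.image (· * v) : Finset (Perm (Fin 5))) := by
  have symm (x : Perm (Fin 5)) (i j : Fin 5) : v * x⁻¹ = swap i j ↔ x = swap i j * v := by
    rw [← inv_inj, mul_inv_rev, inv_inv, swap_inv, mul_inv_eq_iff_eq_mul]
  have ne (i j : Fin 5) (hij : i ≠ j) : v ≠ swap i j * v := fun h =>
    hij (swap_eq_one_iff.mp (mul_eq_right.mp h.symm))
  ext x
  simp only [closedNbr, Set.mem_insert_iff, SimpleGraph.mem_neighborSet,
    SimpleGraph.fromRel_adj, Finset.coe_image, sphereAtOne, Set.mem_image,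
    Finset.mem_coe, Finset.mem_insert, Finset.mem_singleton, exists_eq_or_imp, exists_eq_left,
    one_mul, symm]
  simp only [mul_inv_eq_iff_eq_mul, or_self]
  constructor
  · rintro (rfl | ⟨-, rfl | rfl | rfl | rfl⟩) <;> simp
  · rintro (rfl | rfl | rfl | rfl | rfl)
    · exact Or.inl rfl
    all_goals exact Or.inr ⟨ne _ _ (by decide), by simp⟩

end FrobeniusPacking

open FrobeniusPacking in
/-- in the Cayley graph of `S₅` with connection set
`{(1 3), (2 3), (3 4), (4 5)}` (0-indexed: `{(0 2), (1 2), (2 3), (3 4)}`), there is a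
1-sphere packing of 20 permutations whose closed neighborhoods cover 100 of the 120
vertices. -/
theorem X3_3_2_packing_twenty
    (G : SimpleGraph (Equiv.Perm (Fin 5)))
    (hG : G = SimpleGraph.fromRel fun g h =>
      h * g⁻¹ = Equiv.swap 0 2 ∨ h * g⁻¹ = Equiv.swap 1 2 ∨ h * g⁻¹ = Equiv.swap 2 3 ∨
        h * g⁻¹ = Equiv.swap 3 4) :
    ∃ J : Set (Equiv.Perm (Fin 5)), IsSpherePacking G J ∧ J.ncard = 20 ∧
      (⋃ v ∈ J, closedNbr G v).ncard = 100 := by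
  subst hG
  refine ⟨frobeniusTwenty, ?_, ?_, ?_⟩
  · intro u hu v hv huv
    simp only [closedNbr_fromRel_eq_image, Finset.disjoint_coe]
    exact disjoint_image_sphereAtOne hu hv huv
  · rw [Set.ncard_coe_finset, card_frobeniusTwenty]
  · simp only [closedNbr_fromRel_eq_image]
    rw [← Finset.coe_biUnion, Set.ncard_coe_finset, Finset.card_biUnion
      fun u hu v hv huv => disjoint_image_sphereAtOne hu hv huv]
    simp only [Finset.card_image_of_injective _ (mul_left_injective _), Finset.sum_const,
      card_frobeniusTwenty]
    decide +kernel
end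

section
/- In the Cayley graph of S₆ with connection set the transpositions {(1 3), (2 3), (3 4), (4 5), (4 6)} (the Cayley graph X³_{3,3} of the double-star tree with two adjacent centers of degree 3), there exists a 1-sphere packing consisting of 96 permutations, whose closed neighborhoods (each of size 6) are pairwise disjoint and cover 576 of the 720 vertices. -/
open Equiv Pointwise

section CayleyPacking

variable {Γ : Type*} [Group Γ]

theorem closedNbr_fromRel_mul_inv_mem {C : Set Γ} (hC : ∀ c ∈ C, c⁻¹ ∈ C) (v : Γ) :
    closedNbr (SimpleGraph.fromRel fun g h => h * g⁻¹ ∈ C) v = (· * v) '' insert 1 C := by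
  ext w
  simp only [closedNbr, Set.mem_insert_iff, SimpleGraph.mem_neighborSet,
    SimpleGraph.fromRel_adj, Set.image_mul_right, Set.mem_preimage, mul_inv_eq_one]
  constructor
  · rintro (h | ⟨-, h | h⟩)
    · exact .inl h
    · exact .inr h
    · exact .inr (by simpa using hC _ h)
  · rintro (h | h)
    · exact .inl h
    · by_cases hw : w = v
      · exact .inl hw
      · exact .inr ⟨Ne.symm hw, .inl h⟩

/-- If `x * y` determines `x ∈ A` and `y ∈ B`, then `A * B` has `|A| * |B|` elements. -/
theorem Set.ncard_mul_of_injOn {A B : Set Γ}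
    (h : Set.InjOn (fun p : Γ × Γ => p.1 * p.2) (A ×ˢ B)) :
    (A * B).ncard = A.ncard * B.ncard := by
  rw [← Set.image_mul_prod, h.ncard_image, Set.ncard_prod]

theorem Set.injOn_mul_subgroup {R : Set Γ} {K : Subgroup Γ}
    (h : ∀ r ∈ R, ∀ s ∈ R, s⁻¹ * r ∈ K → r = s) :
    Set.InjOn (fun p : Γ × Γ => p.1 * p.2) (R ×ˢ (K : Set Γ)) := by
  rintro ⟨r, k⟩ ⟨hr, hk⟩ ⟨s, l⟩ ⟨hs, hl⟩ (e : r * k = s * l)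
  have hsr : s⁻¹ * r = l * k⁻¹ := by
    rw [inv_mul_eq_iff_eq_mul, ← mul_assoc, ← e, mul_inv_cancel_right]
  obtain rfl := h r hr s hs (hsr ▸ K.mul_mem hl (K.inv_mem hk))
  rw [mul_left_cancel e]

/-- If the products `b * r` (`b ∈ B`, `r ∈ R`) are distinct and lie in distinct left cosets
of `K`, then the factors of a product in `B * (R * K)` are unique. -/
theorem Set.injOn_mul_mul_subgroup {B R : Set Γ} {K : Subgroup Γ}
    (h : ∀ b ∈ B, ∀ r ∈ R, ∀ c ∈ B, ∀ s ∈ R, (c * s)⁻¹ * (b * r) ∈ K → b = c ∧ r = s) :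
    Set.InjOn (fun p : Γ × Γ => p.1 * p.2) (B ×ˢ (R * (K : Set Γ))) := by
  rintro ⟨b, _⟩ ⟨hb, r, hr, k, hk, rfl⟩ ⟨c, _⟩ ⟨hc, s, hs, l, hl, rfl⟩
    (e : b * (r * k) = c * (s * l))
  have hcs : (c * s)⁻¹ * (b * r) = l * k⁻¹ := by
    rw [inv_mul_eq_iff_eq_mul, eq_comm, ← mul_assoc, mul_inv_eq_iff_eq_mul, mul_assoc c,
      ← e, mul_assoc b]
  obtain ⟨rfl, rfl⟩ := h b hb r hr c hc s hs (hcs ▸ K.mul_mem hl (K.inv_mem hk))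
  simpa using e

theorem isSpherePacking_of_injOn_mul {G : SimpleGraph Γ} {B J : Set Γ}
    (hG : ∀ v, closedNbr G v = (· * v) '' B)
    (h : Set.InjOn (fun p : Γ × Γ => p.1 * p.2) (B ×ˢ J)) : IsSpherePacking G J := by
  intro u hu v hv huv
  rw [hG, hG, Set.disjoint_left]
  rintro _ ⟨b, hb, rfl⟩ ⟨c, hc, e⟩
  exact huv (congrArg Prod.snd (h (Set.mk_mem_prod hc hv) (Set.mk_mem_prod hb hu) e)).symm

theorem iUnion_closedNbr_eq_mul {G : SimpleGraph Γ} {B J : Set Γ}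
    (hG : ∀ v, closedNbr G v = (· * v) '' B) : ⋃ v ∈ J, closedNbr G v = B * J := by
  simp only [hG]
  exact Set.iUnion_mul_right_image

end CayleyPacking

/-- Label the outward normals of a cube so that `0, 1`, `2, 4` and `3, 5` are opposite pairs.
This is the cross product of two normals, or the second one if they are parallel. -/
def cubeCross (i j : Fin 6) : Fin 6 :=
  ![![0, 1, 3, 4, 5, 2], ![0, 1, 5, 2, 3, 4], ![5, 3, 2, 0, 4, 1],
    ![2, 4, 1, 3, 0, 5], ![3, 5, 2, 1, 4, 0], ![4, 2, 0, 3, 1, 5]] i j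

/-- The rotation group of the cube, acting on its six faces. -/
def cubeRotations : Subgroup (Perm (Fin 6)) where
  carrier := {σ | ∀ i j, σ (cubeCross i j) = cubeCross (σ i) (σ j)}
  mul_mem' hσ hτ i j := by simp only [Perm.mul_apply, hτ i j, hσ (_) (_)]
  one_mem' _ _ := rfl
  inv_mem' {σ} hσ i j := by rw [Perm.inv_eq_iff_eq, hσ]; simp

instance : DecidablePred (· ∈ cubeRotations) := fun σ =>
  inferInstanceAs (Decidable (∀ i j, σ (cubeCross i j) = cubeCross (σ i) (σ j)))

theorem ncard_cubeRotations : (cubeRotations : Set (Perm (Fin 6))).ncard = 24 := by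
  have h : (Finset.univ.filter (· ∈ cubeRotations)).card = 24 := by decide +kernel
  rw [← h, ← Set.ncard_coe_finset]
  simp

/-- The identity and the transpositions from the edges of the double star. -/
def doubleStarBall : Finset (Perm (Fin 6)) :=
  {1, swap 0 2, swap 1 2, swap 2 3, swap 3 4, swap 3 5}

/-- Representatives of the left cosets of `cubeRotations` that make up the packing. -/
def packingReps : Finset (Perm (Fin 6)) :=
  {1, swap 1 3 * swap 3 4, swap 1 4 * swap 4 3, swap 1 5 * swap 5 2}

theorem eq_and_eq_of_mem_cubeRotations :
    ∀ b ∈ doubleStarBall, ∀ r ∈ packingReps, ∀ c ∈ doubleStarBall, ∀ s ∈ packingReps,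
      (c * s)⁻¹ * (b * r) ∈ cubeRotations → b = c ∧ r = s := by
  decide +kernel

/-- in the Cayley graph of `S₆` with connection set
`{(1 3), (2 3), (3 4), (4 5), (4 6)}` (0-indexed: `{(0 2), (1 2), (2 3), (3 4), (3 5)}`),
there is a 1-sphere packing of 96 permutations whose closed neighborhoods cover 576 of
the 720 vertices. -/
theorem X3_3_3_packing_ninety_six
    (G : SimpleGraph (Equiv.Perm (Fin 6)))
    (hG : G = SimpleGraph.fromRel fun g h =>
      h * g⁻¹ = Equiv.swap 0 2 ∨ h * g⁻¹ = Equiv.swap 1 2 ∨ h * g⁻¹ = Equiv.swap 2 3 ∨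
        h * g⁻¹ = Equiv.swap 3 4 ∨ h * g⁻¹ = Equiv.swap 3 5) :
    ∃ J : Set (Equiv.Perm (Fin 6)), IsSpherePacking G J ∧ J.ncard = 96 ∧
      (⋃ v ∈ J, closedNbr G v).ncard = 576 := by
  have hN : ∀ v, closedNbr G v = (· * v) '' (doubleStarBall : Set (Perm (Fin 6))) := by
    intro v
    have h := closedNbr_fromRel_mul_inv_mem
      (C := {swap 0 2, swap 1 2, swap 2 3, swap 3 4, swap 3 5}) (by simp) v
    simpa [hG, doubleStarBall] using h
  have hinj := Set.injOn_mul_mul_subgroup (B := (doubleStarBall : Set (Perm (Fin 6))))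
    (R := packingReps) eq_and_eq_of_mem_cubeRotations
  have hcard : ((packingReps : Set (Perm (Fin 6))) * (cubeRotations : Set _)).ncard = 96 := by
    rw [Set.ncard_mul_of_injOn, ncard_cubeRotations, Set.ncard_coe_finset,
      show packingReps.card = 4 by decide +kernel]
    refine Set.injOn_mul_subgroup fun r hr s hs h => ?_
    have h1 : (1 : Perm (Fin 6)) ∈ doubleStarBall := by simp [doubleStarBall]
    exact (eq_and_eq_of_mem_cubeRotations 1 h1 r hr 1 h1 s hs (by simpa using h)).2
  refine ⟨_, isSpherePacking_of_injOn_mul hN hinj, hcard, ?_⟩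
  rw [iUnion_closedNbr_eq_mul hN, Set.ncard_mul_of_injOn hinj, hcard, Set.ncard_coe_finset,
    show doubleStarBall.card = 6 by decide +kernel]
end
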